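/- arXiv:1606.05095 — 2 statements merged into one kernel-verified Lean document; each statement's English description precedes it below -/
import Mathlib

section
/- For octonions x, a with |x| < 1, |a| < 1, the identity conj(B(x,a)) · x̄ = D̄_a ( (1 - |a|²|x|²) / |1 - a x̄|⁸ ) holds, where B(x,a) is the octonionic Bergman kernel [6(1-|a|²|x|²) + 2(1 - x̄a)](1 - x̄a)/|1 - x̄a|^{10}. -/
noncomputable section
open MeasureTheory Metric
open scoped Quaternion

/-- The octonions, via the Cayley–Dickson construction on the quaternions,
carrying the Euclidean (`L²`) norm. -/
abbrev Octonion : Type := WithLp 2 (ℍ[ℝ] × ℍ[ℝ])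

namespace Octonion

def mk (a b : ℍ[ℝ]) : Octonion := (WithLp.equiv 2 (ℍ[ℝ] × ℍ[ℝ])).symm (a, b)
def p1 (x : Octonion) : ℍ[ℝ] := (WithLp.equiv 2 (ℍ[ℝ] × ℍ[ℝ]) x).1
def p2 (x : Octonion) : ℍ[ℝ] := (WithLp.equiv 2 (ℍ[ℝ] × ℍ[ℝ]) x).2

instance : One Octonion := ⟨mk 1 0⟩
/-- Cayley–Dickson multiplication: `(a,b)(c,d) = (ac - d̄b, da + bc̄)`. -/
instance : Mul Octonion :=
  ⟨fun x y => mk (p1 x * p1 y - star (p2 y) * p2 x) (p2 y * p1 x + p2 x * star (p1 y))⟩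

/-- Octonionic conjugation. -/
def conj (x : Octonion) : Octonion := mk (star (p1 x)) (-(p2 x))

/-- The standard basis `e₀ = 1, e₁, …, e₇` of the octonions. -/
def e : Fin 8 → Octonion
  | 0 => mk 1 0
  | 1 => mk ⟨0,1,0,0⟩ 0
  | 2 => mk ⟨0,0,1,0⟩ 0
  | 3 => mk ⟨0,0,0,1⟩ 0
  | 4 => mk 0 1
  | 5 => mk 0 ⟨0,1,0,0⟩
  | 6 => mk 0 ⟨0,0,1,0⟩
  | 7 => mk 0 ⟨0,0,0,1⟩

/-- The real coordinates of an octonion w.r.t. the basis `e`. -/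
def coord (i : Fin 8) (x : Octonion) : ℝ :=
  match i with
  | 0 => (p1 x).re | 1 => (p1 x).imI | 2 => (p1 x).imJ | 3 => (p1 x).imK
  | 4 => (p2 x).re | 5 => (p2 x).imI | 6 => (p2 x).imJ | 7 => (p2 x).imK

/-- Partial derivative in the direction `e i`. -/
def pd (i : Fin 8) (f : Octonion → Octonion) (x : Octonion) : Octonion :=
  fderiv ℝ f x (e i)

/-- The generalized Cauchy–Riemann operator `Df = ∑ eᵢ ∂f/∂xᵢ`. -/
def D (f : Octonion → Octonion) (x : Octonion) : Octonion := ∑ i, e i * pd i f x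

/-- The right-acting Cauchy–Riemann operator `fD = ∑ (∂f/∂xᵢ) eᵢ`. -/
def Dright (f : Octonion → Octonion) (x : Octonion) : Octonion := ∑ i, pd i f x * e i

/-- The conjugate Cauchy–Riemann operator `D̄f = ∑ ēᵢ ∂f/∂xᵢ`. -/
def Dbar (f : Octonion → Octonion) (x : Octonion) : Octonion := ∑ i, conj (e i) * pd i f x

/-- The Laplacian `Δf = ∑ ∂²f/∂xᵢ²`. -/
def lap (f : Octonion → Octonion) (x : Octonion) : Octonion :=
  ∑ i, fderiv ℝ (fun y => fderiv ℝ f y (e i)) x (e i)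

instance : MeasurableSpace Octonion := borel _
instance : BorelSpace Octonion := ⟨rfl⟩
instance : MeasureSpace Octonion := ⟨Measure.addHaar⟩

/-- The surface measure on the unit sphere `S⁷`. -/
def sphereMeasure : Measure (sphere (0 : Octonion) 1) := (volume : Measure Octonion).toSphere

/-- `ω₈`, the surface area of the unit sphere in `ℝ⁸`. -/
def ω : ℝ := (sphereMeasure Set.univ).toReal

end Octonion

/-- The octonionic Bergman kernel of the unit ball. -/
def bergmanKernel (x a : Octonion) : Octonion :=
  (‖(1 : Octonion) - Octonion.conj x * a‖ ^ 10)⁻¹ •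
    (((6 * (1 - ‖a‖ ^ 2 * ‖x‖ ^ 2)) • (1 : Octonion) +
        (2 : ℝ) • ((1 : Octonion) - Octonion.conj x * a)) *
      ((1 : Octonion) - Octonion.conj x * a))

namespace Octonion

theorem ext' {x y : Octonion} (h1 : p1 x = p1 y) (h2 : p2 x = p2 y) : x = y := by
  apply (WithLp.equiv 2 (ℍ[ℝ] × ℍ[ℝ])).injective
  exact Prod.ext h1 h2

theorem p1_mk (a b : ℍ[ℝ]) : p1 (mk a b) = a := rfl
theorem p2_mk (a b : ℍ[ℝ]) : p2 (mk a b) = b := rfl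
theorem p1_mk_re (r i j k : ℝ) (q : ℍ[ℝ]) : (p1 (mk ⟨r, i, j, k⟩ q)).re = r := rfl
theorem p1_mk_imI (r i j k : ℝ) (q : ℍ[ℝ]) : (p1 (mk ⟨r, i, j, k⟩ q)).imI = i := rfl
theorem p1_mk_imJ (r i j k : ℝ) (q : ℍ[ℝ]) : (p1 (mk ⟨r, i, j, k⟩ q)).imJ = j := rfl
theorem p1_mk_imK (r i j k : ℝ) (q : ℍ[ℝ]) : (p1 (mk ⟨r, i, j, k⟩ q)).imK = k := rfl
theorem p2_mk_l (r i j k : ℝ) (q : ℍ[ℝ]) : p2 (mk ⟨r, i, j, k⟩ q) = q := rfl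
theorem p2_mk_re (r i j k : ℝ) (q : ℍ[ℝ]) : (p2 (mk q ⟨r, i, j, k⟩)).re = r := rfl
theorem p2_mk_imI (r i j k : ℝ) (q : ℍ[ℝ]) : (p2 (mk q ⟨r, i, j, k⟩)).imI = i := rfl
theorem p2_mk_imJ (r i j k : ℝ) (q : ℍ[ℝ]) : (p2 (mk q ⟨r, i, j, k⟩)).imJ = j := rfl
theorem p2_mk_imK (r i j k : ℝ) (q : ℍ[ℝ]) : (p2 (mk q ⟨r, i, j, k⟩)).imK = k := rfl
theorem p1_mk_r (r i j k : ℝ) (q : ℍ[ℝ]) : p1 (mk q ⟨r, i, j, k⟩) = q := rfl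
theorem p1_one : p1 1 = 1 := rfl
theorem p2_one : p2 1 = 0 := rfl
theorem p1_zero : p1 0 = 0 := rfl
theorem p2_zero : p2 0 = 0 := rfl
theorem p1_add (x y : Octonion) : p1 (x + y) = p1 x + p1 y := rfl
theorem p2_add (x y : Octonion) : p2 (x + y) = p2 x + p2 y := rfl
theorem p1_sub (x y : Octonion) : p1 (x - y) = p1 x - p1 y := rfl
theorem p2_sub (x y : Octonion) : p2 (x - y) = p2 x - p2 y := rfl
theorem p1_smul (r : ℝ) (y : Octonion) : p1 (r • y) = r • p1 y := rfl
theorem p2_smul (r : ℝ) (y : Octonion) : p2 (r • y) = r • p2 y := rfl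
theorem p1_mul (x y : Octonion) : p1 (x * y) = p1 x * p1 y - star (p2 y) * p2 x := rfl
theorem p2_mul (x y : Octonion) : p2 (x * y) = p2 y * p1 x + p2 x * star (p1 y) := rfl
theorem p1_conj (x : Octonion) : p1 (conj x) = star (p1 x) := rfl
theorem p2_conj (x : Octonion) : p2 (conj x) = -(p2 x) := rfl

theorem inner_eq (x y : Octonion) : inner ℝ x y =
    (p1 x).re * (p1 y).re + (p1 x).imI * (p1 y).imI + (p1 x).imJ * (p1 y).imJ +
      (p1 x).imK * (p1 y).imK + (p2 x).re * (p2 y).re + (p2 x).imI * (p2 y).imI +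
      (p2 x).imJ * (p2 y).imJ + (p2 x).imK * (p2 y).imK := by
  rw [WithLp.prod_inner_apply]
  change inner ℝ (p1 x) (p1 y) + inner ℝ (p2 x) (p2 y) = _
  rw [Quaternion.inner_def, Quaternion.inner_def]
  simp
  ring

theorem norm_sq_eq (x : Octonion) : ‖x‖ ^ 2 =
    (p1 x).re ^ 2 + (p1 x).imI ^ 2 + (p1 x).imJ ^ 2 + (p1 x).imK ^ 2 +
      (p2 x).re ^ 2 + (p2 x).imI ^ 2 + (p2 x).imJ ^ 2 + (p2 x).imK ^ 2 := by
  rw [← real_inner_self_eq_norm_sq, inner_eq]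
  ring

theorem M_left (x a : Octonion) :
    ‖(1 : Octonion) - conj x * a‖ ^ 2 = 1 - 2 * inner ℝ x a + ‖a‖ ^ 2 * ‖x‖ ^ 2 := by
  rw [norm_sq_eq, norm_sq_eq a, norm_sq_eq x, inner_eq]
  simp [p1_sub, p2_sub, p1_mul, p2_mul, p1_conj, p2_conj, p1_one, p2_one]
  ring

theorem M_right (x a : Octonion) :
    ‖(1 : Octonion) - a * conj x‖ ^ 2 = 1 - 2 * inner ℝ x a + ‖a‖ ^ 2 * ‖x‖ ^ 2 := by
  rw [norm_sq_eq, norm_sq_eq a, norm_sq_eq x, inner_eq]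
  simp [p1_sub, p2_sub, p1_mul, p2_mul, p1_conj, p2_conj, p1_one, p2_one]
  ring

theorem u_sq (u : Octonion) : u * u = (2 * (p1 u).re) • u - (‖u‖ ^ 2) • (1 : Octonion) := by
  rw [norm_sq_eq]
  apply ext' <;> ext <;>
    simp [p1_sub, p2_sub, p1_mul, p2_mul, p1_smul, p2_smul, p1_one, p2_one] <;> ring

theorem re_u (x a : Octonion) : (p1 ((1 : Octonion) - conj x * a)).re = 1 - inner ℝ x a := by
  rw [inner_eq]
  simp [p1_sub, p1_mul, p1_conj, p2_conj, p1_one]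
  ring

theorem conj_u_mul (x a : Octonion) :
    conj ((1 : Octonion) - conj x * a) * conj x = conj (x - (‖x‖ ^ 2) • a) := by
  rw [norm_sq_eq]
  apply ext' <;> ext <;>
    simp [p1_sub, p2_sub, p1_mul, p2_mul, p1_conj, p2_conj, p1_smul, p2_smul, p1_one, p2_one] <;>
    ring

theorem add_mul' (x y z : Octonion) : (x + y) * z = x * z + y * z := by
  apply ext'
  · simp only [p1_add, p2_add, p1_mul]; noncomm_ring
  · simp only [p1_add, p2_add, p2_mul]; noncomm_ring

theorem smul_mul' (r : ℝ) (y z : Octonion) : (r • y) * z = r • (y * z) := by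
  apply ext' <;> ext <;> simp [p1_smul, p2_smul, p1_mul, p2_mul] <;> ring

theorem one_mul' (z : Octonion) : 1 * z = z := by
  apply ext' <;> simp [p1_one, p2_one, p1_mul, p2_mul]

theorem conj_add (x y : Octonion) : conj (x + y) = conj x + conj y := by
  apply ext' <;> simp [p1_add, p2_add, p1_conj, p2_conj, add_comm]

theorem conj_sub (x y : Octonion) : conj (x - y) = conj x - conj y := by
  apply ext' <;> simp [p1_sub, p2_sub, p1_conj, p2_conj] ; abel

theorem conj_smul (r : ℝ) (y : Octonion) : conj (r • y) = r • conj y := by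
  apply ext' <;> simp [p1_smul, p2_smul, p1_conj, p2_conj]

theorem conj_one : conj 1 = 1 := by
  apply ext' <;> simp [p1_one, p2_one, p1_conj, p2_conj]

/-- `∑ conj(eᵢ) ⟨G, eᵢ⟩ = conj G`. -/
theorem sum_grad (G : Octonion) :
    ∑ i, conj (e i) * ((inner ℝ G (e i) : ℝ) • (1 : Octonion)) = conj G := by
  simp only [Fin.sum_univ_eight, inner_eq]
  apply ext' <;> ext <;>
    simp [e, p1_mk, p2_mk, p1_mk_re, p1_mk_imI, p1_mk_imJ, p1_mk_imK, p2_mk_l,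
      p2_mk_re, p2_mk_imI, p2_mk_imJ, p2_mk_imK, p1_mk_r, p1_add, p2_add, p1_mul, p2_mul, p1_conj, p2_conj, p1_smul, p2_smul,
      p1_one, p2_one]

theorem lhs_eq (x a : Octonion) :
    conj (bergmanKernel x a) * conj x =
      ((1 - 2 * inner ℝ x a + ‖a‖ ^ 2 * ‖x‖ ^ 2) ^ 5)⁻¹ •
        conj ((8 * (1 - ‖a‖ ^ 2 * ‖x‖ ^ 2)) • (x - (‖x‖ ^ 2) • a) -
          (2 * (1 - 2 * inner ℝ x a + ‖a‖ ^ 2 * ‖x‖ ^ 2) * ‖x‖ ^ 2) • a) := by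
  have h10 : ‖(1 : Octonion) - conj x * a‖ ^ 10 =
      (1 - 2 * inner ℝ x a + ‖a‖ ^ 2 * ‖x‖ ^ 2) ^ 5 := by
    rw [← M_left]; ring
  unfold bergmanKernel
  rw [h10, conj_smul, smul_mul']
  congr 1
  rw [add_mul', smul_mul', smul_mul', one_mul', u_sq, re_u, M_left]
  have hneg : ∀ p q : Octonion, (p - q) * conj x = p * conj x - q * conj x := by
    intro p q
    have := add_mul' (p - q) q (conj x)
    rw [sub_add_cancel] at this
    rw [this, add_sub_cancel_right]
  simp only [conj_add, conj_smul, conj_one, add_mul', smul_mul', conj_sub (_ • _) ((_ : ℝ) • (1 : Octonion)), hneg, one_mul',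
    conj_u_mul]
  simp only [conj_add, conj_smul, conj_sub]
  module

theorem hasFDerivAt_kernel {E : Type*} [NormedAddCommGroup E] [InnerProductSpace ℝ E] (x a : E)
    (h : 1 - 2 * inner ℝ x a + ‖a‖ ^ 2 * ‖x‖ ^ 2 ≠ 0) :
    HasFDerivAt (fun b : E => (1 - ‖b‖ ^ 2 * ‖x‖ ^ 2) *
        ((1 - 2 * inner ℝ x b + ‖b‖ ^ 2 * ‖x‖ ^ 2) ^ 4)⁻¹)
      (innerSL ℝ (((1 - 2 * inner ℝ x a + ‖a‖ ^ 2 * ‖x‖ ^ 2) ^ 5)⁻¹ •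
        ((8 * (1 - ‖a‖ ^ 2 * ‖x‖ ^ 2)) • (x - (‖x‖ ^ 2) • a) -
          (2 * (1 - 2 * inner ℝ x a + ‖a‖ ^ 2 * ‖x‖ ^ 2) * ‖x‖ ^ 2) • a))) a := by
  have hn : HasFDerivAt (fun b : E => ‖b‖ ^ 2) (2 • innerSL ℝ a) a :=
    (hasStrictFDerivAt_norm_sq a).hasFDerivAt
  have hi : HasFDerivAt (fun b : E => (inner ℝ x b : ℝ)) (innerSL ℝ x) a :=
    (innerSL ℝ x).hasFDerivAt
  have hN := (hn.mul_const (‖x‖ ^ 2)).const_sub 1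
  have hM := ((hi.const_mul 2).const_sub 1).add (hn.mul_const (‖x‖ ^ 2))
  have hMi := (hasDerivAt_inv (pow_ne_zero 4 h)).comp_hasFDerivAt a (hM.pow 4)
  refine (hN.mul hMi).congr_fderiv ?_
  ext v
  simp [inner_smul_left, inner_sub_left]
  generalize ‖a‖ ^ 2 = A at *
  generalize ‖x‖ ^ 2 = X at *
  generalize inner ℝ x a = P at *
  generalize inner ℝ x v = Q at *
  generalize inner ℝ a v = R at *
  field_simp
  ring

theorem rhs_eq (x a : Octonion) (h : 1 - 2 * inner ℝ x a + ‖a‖ ^ 2 * ‖x‖ ^ 2 ≠ 0) :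
    Dbar (fun b =>
        ((1 - ‖b‖ ^ 2 * ‖x‖ ^ 2) / ‖(1 : Octonion) - b * conj x‖ ^ 8) • (1 : Octonion)) a =
      ((1 - 2 * inner ℝ x a + ‖a‖ ^ 2 * ‖x‖ ^ 2) ^ 5)⁻¹ •
        conj ((8 * (1 - ‖a‖ ^ 2 * ‖x‖ ^ 2)) • (x - (‖x‖ ^ 2) • a) -
          (2 * (1 - 2 * inner ℝ x a + ‖a‖ ^ 2 * ‖x‖ ^ 2) * ‖x‖ ^ 2) • a) := by
  have hf : (fun b : Octonion =>
        ((1 - ‖b‖ ^ 2 * ‖x‖ ^ 2) / ‖(1 : Octonion) - b * conj x‖ ^ 8) • (1 : Octonion)) =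
      fun b => ((1 - ‖b‖ ^ 2 * ‖x‖ ^ 2) *
        ((1 - 2 * inner ℝ x b + ‖b‖ ^ 2 * ‖x‖ ^ 2) ^ 4)⁻¹) • (1 : Octonion) := by
    funext b
    rw [← M_right, div_eq_mul_inv, ← pow_mul]
  have hT := (hasFDerivAt_kernel x a h).smul_const (1 : Octonion)
  rw [hf, ← conj_smul, ← sum_grad]
  unfold Dbar pd
  rw [hT.fderiv]
  refine Finset.sum_congr rfl fun i _ => ?_
  rw [ContinuousLinearMap.smulRight_apply, innerSL_apply_apply]

end Octonion

/-- `conj(B(x,a)) x̄ = D̄ₐ((1 - |a|²|x|²)/|1 - a x̄|⁸)` for `|x| < 1`, `|a| < 1`. -/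
theorem bergman_kernel_conj_identity (x a : Octonion) (hx : ‖x‖ < 1) (ha : ‖a‖ < 1) :
    Octonion.conj (bergmanKernel x a) * Octonion.conj x =
      Octonion.Dbar (fun b =>
        ((1 - ‖b‖ ^ 2 * ‖x‖ ^ 2) / ‖(1 : Octonion) - b * Octonion.conj x‖ ^ 8) •
          (1 : Octonion)) a := by
  have h : 1 - 2 * inner ℝ x a + ‖a‖ ^ 2 * ‖x‖ ^ 2 ≠ 0 := by
    have h1 := real_inner_le_norm x a
    have h2 : ‖x‖ * ‖a‖ < 1 := by nlinarith [norm_nonneg x, norm_nonneg a]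
    have h3 : 0 < (1 - ‖x‖ * ‖a‖) ^ 2 := by
      have : 0 < 1 - ‖x‖ * ‖a‖ := by linarith
      positivity
    nlinarith
  rw [Octonion.lhs_eq, Octonion.rhs_eq x a h]
end
end

section
/- Let f(x) = x₁ - x₀e₁ and g(x) = (x̄/|x|^{12})(x₁x₂ e₄ + x₀x₂ e₅ + x₀x₁ e₆), functions of x = Σ_{i=0}^7 x_i e_i ∈ 𝕆 \ {0}. Then the inner product (f, g)_{S⁷} := (1/ω₈) ∫_{S⁷} (conj(g(η)) η̄)(η f(η)) dS equals (-2e₆/ω₈) ∫_{S⁷} x₀²x₁² dS, which is nonzero. -/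
noncomputable section
open MeasureTheory Metric
open scoped Quaternion

open Octonion in
/-- The modified inner product on `L²(S⁷)`:
`(f,g) = (1/ω₈) ∫_{S⁷} (conj(g(η)) η̄)(η f(η)) dS`. -/
def sphereInner (f g : Octonion → Octonion) : Octonion :=
  (Octonion.ω)⁻¹ • ∫ η : sphere (0 : Octonion) 1,
    ((Octonion.conj (g η) * Octonion.conj (η : Octonion)) * ((η : Octonion) * f η))
    ∂Octonion.sphereMeasure

namespace Octonion

open scoped Pointwise in
theorem integral_invol {E : Type*} [NormedAddCommGroup E] [NormedSpace ℝ E] [MeasurableSpace E]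
    [BorelSpace E] [FiniteDimensional ℝ E] (μ : Measure E) [μ.IsAddHaarMeasure]
    (L : E →ₗ[ℝ] E) (hL : ∀ x, L (L x) = x) (hn : ∀ x, ‖L x‖ = ‖x‖) (F : E → ℝ) :
    ∫ η : sphere (0 : E) 1, F (L η) ∂μ.toSphere = ∫ η : sphere (0 : E) 1, F η ∂μ.toSphere := by
  have hdet : |LinearMap.det L| = 1 := by
    have h1 : L * L = 1 := by ext x; exact hL x
    have h2 : LinearMap.det L * LinearMap.det L = 1 := by rw [← map_mul, h1, map_one]
    rcases mul_self_eq_one_iff.1 h2 with h | h <;> simp [h]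
  have hc : Continuous L := L.continuous_of_finiteDimensional
  let T : sphere (0 : E) 1 ≃ₜ sphere (0 : E) 1 :=
    { toFun := fun η => ⟨L η, by simp [hn]⟩
      invFun := fun η => ⟨L η, by simp [hn]⟩
      left_inv := fun η => Subtype.ext (hL _)
      right_inv := fun η => Subtype.ext (hL _)
      continuous_toFun := by fun_prop
      continuous_invFun := by fun_prop }
  have hT : ∀ η, ((T η : sphere (0 : E) 1) : E) = L η := fun η => rfl
  have hmp : MeasurePreserving T μ.toSphere μ.toSphere := by
    refine ⟨T.continuous.measurable, ?_⟩
    ext s hs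
    rw [Measure.map_apply T.continuous.measurable hs,
      Measure.toSphere_apply' _ (T.continuous.measurable hs), Measure.toSphere_apply' _ hs]
    congr 1
    have h3 : (Subtype.val '' (T ⁻¹' s) : Set E) = L '' (Subtype.val '' s) := by
      ext y
      constructor
      · rintro ⟨η, hη, rfl⟩
        exact ⟨L η, ⟨T η, hη, rfl⟩, hL _⟩
      · rintro ⟨_, ⟨η, hη, rfl⟩, rfl⟩
        refine ⟨T η, ?_, rfl⟩
        have : T (T η) = η := Subtype.ext (hL _)
        simpa [this] using hη
    have h4 : Set.Ioo (0 : ℝ) 1 • (L '' (Subtype.val '' s)) =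
        L '' (Set.Ioo (0 : ℝ) 1 • (Subtype.val '' s : Set E)) := by
      ext y
      constructor
      · rintro ⟨r, hr, _, ⟨z, hz, rfl⟩, rfl⟩
        exact ⟨r • z, ⟨r, hr, z, hz, rfl⟩, by simp⟩
      · rintro ⟨_, ⟨r, hr, z, hz, rfl⟩, rfl⟩
        exact ⟨r, hr, L z, ⟨z, hz, rfl⟩, by simp⟩
    rw [h3, h4, Measure.addHaar_image_linearMap, hdet]
    simp
  exact hmp.integral_comp T.measurableEmbedding (fun η : sphere (0 : E) 1 => F η)

def ofC (c : Fin 8 → ℝ) : Octonion := mk ⟨c 0, c 1, c 2, c 3⟩ ⟨c 4, c 5, c 6, c 7⟩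

theorem coord_ofC (c : Fin 8 → ℝ) (i : Fin 8) : coord i (ofC c) = c i := by
  fin_cases i <;> rfl

theorem ext_coord {x y : Octonion} (h : ∀ i, coord i x = coord i y) : x = y := by
  have h1 : p1 x = p1 y := by
    ext
    exacts [h 0, h 1, h 2, h 3]
  have h2 : p2 x = p2 y := by
    ext
    exacts [h 4, h 5, h 6, h 7]
  apply (WithLp.equiv 2 (ℍ[ℝ] × ℍ[ℝ])).injective
  exact Prod.ext h1 h2

theorem coord_add (i : Fin 8) (x y : Octonion) : coord i (x + y) = coord i x + coord i y := by
  fin_cases i <;> rfl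
theorem coord_sub (i : Fin 8) (x y : Octonion) : coord i (x - y) = coord i x - coord i y := by
  fin_cases i <;> rfl
theorem coord_smul (i : Fin 8) (r : ℝ) (y : Octonion) : coord i (r • y) = r * coord i y := by
  fin_cases i <;> rfl

theorem norm_sq_coord (x : Octonion) : ‖x‖ ^ 2 = ∑ i, coord i x ^ 2 := by
  rw [WithLp.prod_norm_sq_eq_of_L2]
  have h : ∀ a : ℍ[ℝ], ‖a‖ ^ 2 = a.re ^ 2 + a.imI ^ 2 + a.imJ ^ 2 + a.imK ^ 2 := by
    intro a
    rw [sq, ← Quaternion.normSq_eq_norm_mul_self, Quaternion.normSq_def']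
  rw [h, h]
  simp [Fin.sum_univ_eight, coord, p1, p2]
  ring

instance : FiniteDimensional ℝ ℍ[ℝ] :=
  Quaternion.linearIsometryEquivTuple.symm.toLinearEquiv.finiteDimensional

instance : FiniteDimensional ℝ Octonion :=
  (WithLp.linearEquiv 2 ℝ (ℍ[ℝ] × ℍ[ℝ])).symm.finiteDimensional

def coordL (i : Fin 8) : Octonion →L[ℝ] ℝ :=
  LinearMap.toContinuousLinearMap
    { toFun := coord i, map_add' := coord_add i, map_smul' := coord_smul i }

theorem coordL_apply (i : Fin 8) (x : Octonion) : coordL i x = coord i x := rfl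

@[fun_prop]
theorem continuous_coord (i : Fin 8) : Continuous (coord i) := (coordL i).continuous

/-- signed permutation of the coordinates -/
def sp (s : Fin 8 → ℝ) (σ : Equiv.Perm (Fin 8)) : Octonion →ₗ[ℝ] Octonion where
  toFun x := ofC (fun i => s i * coord (σ i) x)
  map_add' x y := ext_coord fun i => by simp only [coord_ofC, coord_add]; ring
  map_smul' r y := ext_coord fun i => by
    simp only [coord_ofC, coord_smul, RingHom.id_apply]; ring

theorem coord_sp (s : Fin 8 → ℝ) (σ : Equiv.Perm (Fin 8)) (i : Fin 8) (x : Octonion) :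
    coord i (sp s σ x) = s i * coord (σ i) x := coord_ofC _ _

instance : (volume : Measure Octonion).IsAddHaarMeasure :=
  inferInstanceAs (Measure.addHaar : Measure Octonion).IsAddHaarMeasure

instance : IsFiniteMeasure sphereMeasure :=
  inferInstanceAs (IsFiniteMeasure (volume : Measure Octonion).toSphere)

instance : sphereMeasure.IsOpenPosMeasure :=
  inferInstanceAs ((volume : Measure Octonion).toSphere.IsOpenPosMeasure)

theorem integral_sp (s : Fin 8 → ℝ) (σ : Equiv.Perm (Fin 8)) (hs : ∀ i, s i * s (σ i) = 1)
    (hs' : ∀ i, s i ^ 2 = 1) (hσ : ∀ i, σ (σ i) = i) (F : Octonion → ℝ) :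
    ∫ η : sphere (0 : Octonion) 1, F (sp s σ η) ∂sphereMeasure =
      ∫ η : sphere (0 : Octonion) 1, F η ∂sphereMeasure := by
  apply integral_invol
  · intro x
    apply ext_coord
    intro i
    rw [coord_sp, coord_sp, ← mul_assoc, hs, hσ, one_mul]
  · intro x
    have : ‖sp s σ x‖ ^ 2 = ‖x‖ ^ 2 := by
      rw [norm_sq_coord, norm_sq_coord]
      simp only [coord_sp, mul_pow, hs', one_mul]
      exact Equiv.sum_comp σ (fun i => coord i x ^ 2)
    exact (sq_eq_sq₀ (norm_nonneg _) (norm_nonneg _)).1 this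

theorem integrable_sphere {F : Octonion → ℝ} (hF : Continuous F) :
    Integrable (fun η : sphere (0 : Octonion) 1 => F η) sphereMeasure := by
  have : CompactSpace (sphere (0 : Octonion) 1) := 
    isCompact_iff_compactSpace.1 (isCompact_sphere _ _)
  have h : Continuous (fun η : sphere (0 : Octonion) 1 => F η) := by fun_prop
  exact h.integrable_of_hasCompactSupport (HasCompactSupport.of_compactSpace _)

/-- averaging -/
theorem integral_avg (s : Fin 8 → ℝ) (σ : Equiv.Perm (Fin 8)) (hs : ∀ i, s i * s (σ i) = 1)
    (hs' : ∀ i, s i ^ 2 = 1) (hσ : ∀ i, σ (σ i) = i) {F : Octonion → ℝ} (hF : Continuous F) :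
    ∫ η : sphere (0 : Octonion) 1, F η ∂sphereMeasure =
      ∫ η : sphere (0 : Octonion) 1, (F η + F (sp s σ η)) / 2 ∂sphereMeasure := by
  have hL : Continuous (sp s σ) := (sp s σ).continuous_of_finiteDimensional
  rw [integral_div, integral_add (integrable_sphere hF)
    (integrable_sphere (F := fun x => F (sp s σ x)) (hF.comp hL)), integral_sp s σ hs hs' hσ]
  ring

theorem mul_def' (x y : Octonion) : x * y =
  mk (p1 x * p1 y - star (p2 y) * p2 x) (p2 y * p1 x + p2 x * star (p1 y)) := rfl
theorem cancel (x h : Octonion) :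
    conj (conj x * h) * conj x = (‖x‖ ^ 2) • conj h := by
  rw [norm_sq_coord]
  apply ext_coord
  intro i
  rw [coord_smul]
  fin_cases i <;>
  · simp [Fin.sum_univ_eight, mul_def', conj, p1_mk, p2_mk, coord]
    ring

/-- the imaginary factor of `g` -/
def hh (x : Octonion) : Octonion :=
  (coord 1 x * coord 2 x) • e 4 + (coord 0 x * coord 2 x) • e 5 + (coord 0 x * coord 1 x) • e 6

/-- the function `f` -/
def ff (x : Octonion) : Octonion := coord 1 x • (1 : Octonion) - coord 0 x • e 1

/-- coordinates of the integrand -/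
def P (c : Fin 8 → ℝ) : Fin 8 → ℝ
  | 0 => c 1 * c 1 * c 2 * c 4 + c 0 * c 0 * c 2 * c 4 + c 0 * c 1 * c 1 * c 6 + c 0 * c 0 * c 1 * c 7
  | 1 => - c 0 * c 0 * c 2 * c 5 - c 1 * c 1 * c 2 * c 5 - c 0 * c 0 * c 1 * c 6 + c 0 * c 1 * c 1 * c 7
  | 2 => c 0 * c 1 * c 1 * c 4 - c 0 * c 0 * c 1 * c 5 - c 1 * c 1 * c 2 * c 6
      - 2 * c 0 * c 1 * c 2 * c 7 + c 0 * c 0 * c 2 * c 6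
  | 3 => - c 0 * c 0 * c 1 * c 4 - c 0 * c 1 * c 1 * c 5 + 2 * c 0 * c 1 * c 2 * c 6
      + c 0 * c 0 * c 2 * c 7 - c 1 * c 1 * c 2 * c 7
  | 4 => - 4 * c 0 * c 1 * c 1 * c 2 + c 0 * c 0 * c 0 * c 2 + c 0 * c 0 * c 1 * c 3
  | 5 => - 2 * c 0 * c 0 * c 1 * c 2 + c 1 * c 1 * c 1 * c 2 + c 0 * c 1 * c 1 * c 3
  | 6 => c 1 * c 1 * c 2 * c 2 - 2 * c 0 * c 1 * c 2 * c 3 - c 0 * c 0 * c 2 * c 2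
      - 2 * c 0 * c 0 * c 1 * c 1
  | 7 => 2 * c 0 * c 1 * c 2 * c 2 + c 1 * c 1 * c 2 * c 3 - c 0 * c 0 * c 2 * c 3
      + c 0 * c 0 * c 0 * c 1 - c 0 * c 1 * c 1 * c 1

theorem hh_eq (x : Octonion) : hh x = ofC ![0, 0, 0, 0, coord 1 x * coord 2 x,
    coord 0 x * coord 2 x, coord 0 x * coord 1 x, 0] := by
  apply ext_coord
  intro i
  have h4 (j : Fin 8) : coord j (e 4) = if j = 4 then 1 else 0 := by fin_cases j <;> rfl
  have h5 (j : Fin 8) : coord j (e 5) = if j = 5 then 1 else 0 := by fin_cases j <;> rfl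
  have h6 (j : Fin 8) : coord j (e 6) = if j = 6 then 1 else 0 := by fin_cases j <;> rfl
  rw [coord_ofC, hh]
  simp only [coord_add, coord_smul, h4, h5, h6]
  fin_cases i <;> simp

theorem ff_eq (x : Octonion) : ff x = ofC ![coord 1 x, - coord 0 x, 0, 0, 0, 0, 0, 0] := by
  apply ext_coord
  intro i
  have h4 (j : Fin 8) : coord j (1 : Octonion) = if j = 0 then 1 else 0 := by fin_cases j <;> rfl
  have h5 (j : Fin 8) : coord j (e 1) = if j = 1 then 1 else 0 := by fin_cases j <;> rfl
  rw [coord_ofC, ff]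
  simp only [coord_sub, coord_smul, h4, h5]
  fin_cases i <;> simp

theorem integrand_coord (x : Octonion) (i : Fin 8) :
    coord i (conj (hh x) * (x * ff x)) = P (fun j => coord j x) i := by
  have a0 : (p1 (hh x)).re = 0 := by rw [hh_eq]; rfl
  have a1 : (p1 (hh x)).imI = 0 := by rw [hh_eq]; rfl
  have a2 : (p1 (hh x)).imJ = 0 := by rw [hh_eq]; rfl
  have a3 : (p1 (hh x)).imK = 0 := by rw [hh_eq]; rfl
  have a4 : (p2 (hh x)).re = (p1 x).imI * (p1 x).imJ := by rw [hh_eq]; rfl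
  have a5 : (p2 (hh x)).imI = (p1 x).re * (p1 x).imJ := by rw [hh_eq]; rfl
  have a6 : (p2 (hh x)).imJ = (p1 x).re * (p1 x).imI := by rw [hh_eq]; rfl
  have a7 : (p2 (hh x)).imK = 0 := by rw [hh_eq]; rfl
  have b0 : (p1 (ff x)).re = (p1 x).imI := by rw [ff_eq]; rfl
  have b1 : (p1 (ff x)).imI = -(p1 x).re := by rw [ff_eq]; rfl
  have b2 : (p1 (ff x)).imJ = 0 := by rw [ff_eq]; rfl
  have b3 : (p1 (ff x)).imK = 0 := by rw [ff_eq]; rfl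
  have b4 : (p2 (ff x)).re = 0 := by rw [ff_eq]; rfl
  have b5 : (p2 (ff x)).imI = 0 := by rw [ff_eq]; rfl
  have b6 : (p2 (ff x)).imJ = 0 := by rw [ff_eq]; rfl
  have b7 : (p2 (ff x)).imK = 0 := by rw [ff_eq]; rfl
  fin_cases i <;>
  · simp [mul_def', conj, p1_mk, p2_mk, coord, P, a0, a1, a2, a3, a4, a5, a6, a7,
      b0, b1, b2, b3, b4, b5, b6, b7]
    ring

theorem integrand_eq (x : Octonion) (hx : ‖x‖ = 1) :
    (conj ((‖x‖ ^ 12)⁻¹ • (conj x * hh x)) * conj x) * (x * ff x) =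
      ofC (P (fun j => coord j x)) := by
  rw [hx, one_pow, inv_one, one_smul, cancel, hx, one_pow, one_smul]
  exact ext_coord fun i => by rw [integrand_coord, coord_ofC]

theorem continuous_P (i : Fin 8) : Continuous (fun x : Octonion => P (fun j => coord j x) i) := by
  fin_cases i <;> simp only [P] <;> fun_prop

theorem ofC_eq_sum (c : Fin 8 → ℝ) : ofC c = ∑ i, c i • e i := by
  apply ext_coord
  intro i
  rw [coord_ofC, ← coordL_apply, map_sum]
  have h (i j : Fin 8) : coord i (e j) = if i = j then 1 else 0 := by
    fin_cases i <;> fin_cases j <;> rfl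
  simp [map_smul, coordL_apply, h]

theorem integral_P (i : Fin 8) :
    ∫ η : sphere (0 : Octonion) 1, P (fun j => coord j (η : Octonion)) i ∂sphereMeasure =
      if i = 6 then -2 * ∫ η : sphere (0 : Octonion) 1,
        (coord 0 (η : Octonion)) ^ 2 * (coord 1 (η : Octonion)) ^ 2 ∂sphereMeasure else 0 := by
  have key : ∀ (s : Fin 8 → ℝ), (∀ i, s i ^ 2 = 1) →
      (∀ x, P (fun j => s j * coord j x) i = - P (fun j => coord j x) i) →
      ∫ η : sphere (0 : Octonion) 1, P (fun j => coord j (η : Octonion)) i ∂sphereMeasure = 0 := by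
    intro s hs hP
    rw [integral_avg s 1 (fun i => by rw [← hs i, sq]; rfl) hs (fun _ => rfl) (continuous_P i)]
    simp [coord_sp, hP]
  fin_cases i
  · simpa using key ![1, 1, 1, 1, -1, -1, -1, -1] (by intro i; fin_cases i <;> norm_num)
      (by intro x; simp [P]; ring)
  · simpa using key ![1, 1, 1, 1, -1, -1, -1, -1] (by intro i; fin_cases i <;> norm_num)
      (by intro x; simp [P]; ring)
  · simpa using key ![1, 1, 1, 1, -1, -1, -1, -1] (by intro i; fin_cases i <;> norm_num)
      (by intro x; simp [P]; ring)
  · simpa using key ![1, 1, 1, 1, -1, -1, -1, -1] (by intro i; fin_cases i <;> norm_num)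
      (by intro x; simp [P]; ring)
  · simpa using key ![1, 1, -1, -1, 1, 1, 1, 1] (by intro i; fin_cases i <;> norm_num)
      (by intro x; simp [P]; ring)
  · simpa using key ![1, 1, -1, -1, 1, 1, 1, 1] (by intro i; fin_cases i <;> norm_num)
      (by intro x; simp [P]; ring)
  · clear key
    change ∫ η : sphere (0 : Octonion) 1, P (fun j => coord j (η : Octonion)) 6 ∂sphereMeasure =
      if (6 : Fin 8) = 6 then _ else _
    rw [integral_avg ![1, 1, 1, -1, 1, 1, 1, 1] (Equiv.swap 0 1)
      (by intro i; fin_cases i <;> simp [Equiv.swap_apply_def])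
      (by intro i; fin_cases i <;> norm_num)
      (by simp) (continuous_P 6)]
    simp only [coord_sp]
    simp only [P]
    rw [if_pos trivial, ← integral_const_mul]
    congr 1
    funext η
    simp [Equiv.swap_apply_def]
    ring
  · simpa using key ![1, -1, -1, 1, 1, 1, 1, 1] (by intro i; fin_cases i <;> norm_num)
      (by intro x; simp [P]; ring)

theorem integral_pos' : 0 < ∫ η : sphere (0 : Octonion) 1,
        (coord 0 (η : Octonion)) ^ 2 * (coord 1 (η : Octonion)) ^ 2 ∂sphereMeasure := by
  have hc : Continuous (fun x : Octonion => (coord 0 x) ^ 2 * (coord 1 x) ^ 2) := by fun_prop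
  have hx : ‖ofC ![3 / 5, 4 / 5, 0, 0, 0, 0, 0, 0]‖ = 1 := by
    have : ‖ofC ![3 / 5, 4 / 5, 0, 0, 0, 0, 0, 0]‖ ^ 2 = 1 ^ 2 := by
      rw [norm_sq_coord]
      simp only [coord_ofC, Fin.sum_univ_eight]
      simp
      norm_num
    exact (sq_eq_sq₀ (norm_nonneg _) zero_le_one).1 this
  have hi := integrable_sphere hc
  rw [integral_pos_iff_support_of_nonneg (fun η => by positivity) hi]
  refine IsOpen.measure_pos _ ?_ ⟨⟨ofC ![3 / 5, 4 / 5, 0, 0, 0, 0, 0, 0], by simp [hx]⟩, ?_⟩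
  · exact (hc.comp continuous_subtype_val).isOpen_support
  · simp [coord_ofC]

theorem omega_ne : ω ≠ 0 := by
  have h := integral_pos'
  intro h0
  have h1 : sphereMeasure Set.univ = 0 :=
    ((ENNReal.toReal_eq_zero_iff _).1 h0).resolve_right (measure_ne_top _ _)
  rw [Measure.measure_univ_eq_zero.1 h1] at h
  simp at h

theorem e6_ne : e 6 ≠ 0 := by
  intro h
  have : coord 6 (e 6) = coord 6 (0 : Octonion) := by rw [h]
  have h1 : coord 6 (e 6) = 1 := rfl
  have h0 : coord 6 (0 : Octonion) = 0 := rfl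
  rw [h1, h0] at this
  exact one_ne_zero this

theorem main_eq : sphereInner ff (fun x => (‖x‖ ^ 12)⁻¹ • (conj x * hh x)) =
      ((-2) * (Octonion.ω)⁻¹ *
          ∫ η : sphere (0 : Octonion) 1,
            (coord 0 (η : Octonion)) ^ 2 * (coord 1 (η : Octonion)) ^ 2
            ∂Octonion.sphereMeasure) • e 6 := by
  have h1 : ∀ η : sphere (0 : Octonion) 1,
      (conj ((‖(η : Octonion)‖ ^ 12)⁻¹ • (conj (η : Octonion) * hh η)) * conj (η : Octonion)) *
        ((η : Octonion) * ff η) = ∑ i, P (fun j => coord j (η : Octonion)) i • e i := by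
    intro η
    rw [integrand_eq _ (by simp), ofC_eq_sum]
  unfold sphereInner
  simp only [h1]
  rw [integral_finsetSum _ (fun i _ => (integrable_sphere (continuous_P i)).smul_const (e i))]
  simp only [integral_smul_const, integral_P]
  simp [smul_smul]
  ring_nf

end Octonion

open Octonion in
/-- For `f(x) = x₁ - x₀e₁` and `g(x) = (x̄/|x|¹²)(x₁x₂e₄ + x₀x₂e₅ + x₀x₁e₆)`,
the inner product `(f,g)_{S⁷}` equals `(-2e₆/ω₈)∫_{S⁷} x₀²x₁² dS ≠ 0`; in particular
`P₁f` and `Q₂g` are not orthogonal. -/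
theorem inner_P1_Q2_ne_zero :
    sphereInner
        (fun x => coord 1 x • (1 : Octonion) - coord 0 x • e 1)
        (fun x => (‖x‖ ^ 12)⁻¹ •
          (Octonion.conj x *
            ((coord 1 x * coord 2 x) • e 4 + (coord 0 x * coord 2 x) • e 5 +
              (coord 0 x * coord 1 x) • e 6))) =
      ((-2) * (Octonion.ω)⁻¹ *
          ∫ η : sphere (0 : Octonion) 1,
            (coord 0 (η : Octonion)) ^ 2 * (coord 1 (η : Octonion)) ^ 2
            ∂Octonion.sphereMeasure) • e 6 ∧
    sphereInner
        (fun x => coord 1 x • (1 : Octonion) - coord 0 x • e 1)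
        (fun x => (‖x‖ ^ 12)⁻¹ •
          (Octonion.conj x *
            ((coord 1 x * coord 2 x) • e 4 + (coord 0 x * coord 2 x) • e 5 +
              (coord 0 x * coord 1 x) • e 6))) ≠ 0 := by
  refine ⟨main_eq, ?_⟩
  refine fun h => ?_
  have h' := main_eq.symm.trans h
  rw [smul_eq_zero] at h'
  rcases h' with h' | h'
  · exact mul_ne_zero (mul_ne_zero (by norm_num) (inv_ne_zero omega_ne)) integral_pos'.ne' h'
  · exact e6_ne h'
end
end
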